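/- arXiv:math/0202095 — 5 statements merged into one kernel-verified Lean document; each statement's English description precedes it below -/
import Mathlib

section
/- Let A be a unital associative ℂ-algebra (possibly noncommutative), N ≥ 1, and let R : ℂ → ℂ → Matrix (Fin N × Fin N) (Fin N × Fin N) ℂ satisfy the Yang–Baxter equation and unitarity. Let T : ℂ → Matrix (Fin N) (Fin N) A satisfy the RTT relation for R, with T(k) invertible for every k ∈ ℂ. Let B : ℂ → Matrix (Fin N) (Fin N) ℂ satisfy the scalar reflection equation for R and B(k)·B(−k) = I for all k. Then the dressed family b(k) := T(k) · B(k) · T(−k)⁻¹ (with B(k) viewed in Matrix (Fin N) (Fin N) A) satisfies the reflection equation for R over A: R(k₁,k₂) b₁(k₁) (R(k₂,−k₁))₂₁ b₂(k₂) = b₂(k₂) R(k₁,−k₂) b₁(k₁) (R(−k₂,−k₁))₂₁ for all k₁, k₂ ∈ ℂ. -/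
open Matrix

/-- `M₁ = M ⊗ I` on `ℂ^N ⊗ ℂ^N`. -/
def emb1 {N : ℕ} {A : Type*} [Semiring A] (M : Matrix (Fin N) (Fin N) A) :
    Matrix (Fin N × Fin N) (Fin N × Fin N) A :=
  fun p q => M p.1 q.1 * (if p.2 = q.2 then 1 else 0)

/-- `M₂ = I ⊗ M` on `ℂ^N ⊗ ℂ^N`. -/
def emb2 {N : ℕ} {A : Type*} [Semiring A] (M : Matrix (Fin N) (Fin N) A) :
    Matrix (Fin N × Fin N) (Fin N × Fin N) A :=
  fun p q => (if p.1 = q.1 then 1 else 0) * M p.2 q.2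

/-- `X₂₁`, with entries `(X₂₁)_{(a,b),(c,d)} = X_{(b,a),(d,c)}`. -/
def swap21 {N : ℕ} {A : Type*} (X : Matrix (Fin N × Fin N) (Fin N × Fin N) A) :
    Matrix (Fin N × Fin N) (Fin N × Fin N) A :=
  fun p q => X (p.2, p.1) (q.2, q.1)

/-- `X₁₂ = X ⊗ I` on `ℂ^N ⊗ ℂ^N ⊗ ℂ^N`. -/
def emb12 {N : ℕ} (X : Matrix (Fin N × Fin N) (Fin N × Fin N) ℂ) :
    Matrix (Fin N × Fin N × Fin N) (Fin N × Fin N × Fin N) ℂ :=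
  fun p q => X (p.1, p.2.1) (q.1, q.2.1) * (if p.2.2 = q.2.2 then 1 else 0)

/-- `X₁₃` on `ℂ^N ⊗ ℂ^N ⊗ ℂ^N`. -/
def emb13 {N : ℕ} (X : Matrix (Fin N × Fin N) (Fin N × Fin N) ℂ) :
    Matrix (Fin N × Fin N × Fin N) (Fin N × Fin N × Fin N) ℂ :=
  fun p q => X (p.1, p.2.2) (q.1, q.2.2) * (if p.2.1 = q.2.1 then 1 else 0)

/-- `X₂₃ = I ⊗ X` on `ℂ^N ⊗ ℂ^N ⊗ ℂ^N`. -/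
def emb23 {N : ℕ} (X : Matrix (Fin N × Fin N) (Fin N × Fin N) ℂ) :
    Matrix (Fin N × Fin N × Fin N) (Fin N × Fin N × Fin N) ℂ :=
  fun p q => (if p.1 = q.1 then 1 else 0) * X (p.2.1, p.2.2) (q.2.1, q.2.2)

section Embeddings

variable {N : ℕ} {A : Type*} [Ring A]

theorem emb1_one : emb1 (1 : Matrix (Fin N) (Fin N) A) = 1 := by
  ext ⟨a, b⟩ ⟨c, d⟩
  by_cases h : a = c <;> by_cases h' : b = d <;> simp [emb1, Matrix.one_apply, h, h']

theorem emb1_mul (M M' : Matrix (Fin N) (Fin N) A) :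
    emb1 (M * M') = emb1 M * emb1 M' := by
  ext ⟨a, b⟩ ⟨c, d⟩
  by_cases h : b = d <;>
    simp [emb1, Matrix.mul_apply, Fintype.sum_prod_type, h]

theorem swap21_mul (X Y : Matrix (Fin N × Fin N) (Fin N × Fin N) A) :
    swap21 (X * Y) = swap21 X * swap21 Y := by
  ext ⟨a, b⟩ ⟨c, d⟩
  simp only [swap21, Matrix.mul_apply, Fintype.sum_prod_type]
  exact Finset.sum_comm

theorem swap21_one : swap21 (1 : Matrix (Fin N × Fin N) (Fin N × Fin N) A) = 1 := by
  ext ⟨a, b⟩ ⟨c, d⟩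
  simp [swap21, Matrix.one_apply, and_comm]

theorem swap21_emb1 (M : Matrix (Fin N) (Fin N) A) : swap21 (emb1 M) = emb2 M := by
  ext ⟨a, b⟩ ⟨c, d⟩
  simp [swap21, emb1, emb2]

theorem swap21_emb2 (M : Matrix (Fin N) (Fin N) A) : swap21 (emb2 M) = emb1 M := by
  ext ⟨a, b⟩ ⟨c, d⟩
  simp [swap21, emb1, emb2]

theorem emb2_one : emb2 (1 : Matrix (Fin N) (Fin N) A) = 1 := by
  rw [← swap21_emb1, emb1_one, swap21_one]

theorem emb2_mul (M M' : Matrix (Fin N) (Fin N) A) :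
    emb2 (M * M') = emb2 M * emb2 M' := by
  simp only [← swap21_emb1, emb1_mul, swap21_mul]

variable [Algebra ℂ A]

theorem emb1_map_algebraMap (M : Matrix (Fin N) (Fin N) ℂ) :
    emb1 (M.map (algebraMap ℂ A)) = (emb1 M).map (algebraMap ℂ A) := by
  ext ⟨a, b⟩ ⟨c, d⟩
  by_cases h : b = d <;> simp [emb1, h]

theorem emb2_map_algebraMap (M : Matrix (Fin N) (Fin N) ℂ) :
    emb2 (M.map (algebraMap ℂ A)) = (emb2 M).map (algebraMap ℂ A) := by
  ext ⟨a, b⟩ ⟨c, d⟩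
  by_cases h : a = c <;> simp [emb2, h]

/-- A scalar matrix in the first tensor factor commutes with any matrix in the second one. -/
theorem commute_emb1_map_emb2 (M : Matrix (Fin N) (Fin N) ℂ) (M' : Matrix (Fin N) (Fin N) A) :
    Commute (emb1 (M.map (algebraMap ℂ A))) (emb2 M') := by
  ext ⟨a, b⟩ ⟨c, d⟩
  simp [emb1, emb2, Matrix.mul_apply, Fintype.sum_prod_type, Algebra.commutes]

/-- A scalar matrix in the second tensor factor commutes with any matrix in the first one. -/
theorem commute_emb2_map_emb1 (M : Matrix (Fin N) (Fin N) ℂ) (M' : Matrix (Fin N) (Fin N) A) :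
    Commute (emb2 (M.map (algebraMap ℂ A))) (emb1 M') := by
  have h := congrArg swap21 (commute_emb1_map_emb2 M M').eq
  rwa [swap21_mul, swap21_mul, swap21_emb1, swap21_emb2] at h

end Embeddings

/-- The dressing computation in a ring: `t₁, t₂` stand for `T₁(k₁), T₂(k₂)`, the pairs
`(u₁, s₁), (u₂, s₂)` for `T₁(-k₁), T₂(-k₂)` and their inverses, and `r, p, q, w` for the
R-matrices at `(k₁, k₂)`, `(k₂, -k₁)₂₁`, `(k₁, -k₂)` and `(-k₂, -k₁)₂₁`. -/
theorem dressed_reflection_of_exchange {G : Type*} [Ring G]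
    {r p q w t₁ t₂ u₁ u₂ s₁ s₂ c₁ c₂ : G}
    (hu₁ : u₁ * s₁ = 1) (hs₁ : s₁ * u₁ = 1) (hu₂ : u₂ * s₂ = 1) (hs₂ : s₂ * u₂ = 1)
    (hr : r * t₁ * t₂ = t₂ * t₁ * r) (hp : p * t₂ * u₁ = u₁ * t₂ * p)
    (hq : q * t₁ * u₂ = u₂ * t₁ * q) (hw : w * u₂ * u₁ = u₁ * u₂ * w)
    (hc : r * c₁ * p * c₂ = c₂ * q * c₁ * w)
    (h₁₂ : Commute c₁ t₂) (h₁₂' : Commute c₁ s₂)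
    (h₂₁ : Commute c₂ t₁) (h₂₁' : Commute c₂ s₁) :
    r * (t₁ * c₁ * s₁) * p * (t₂ * c₂ * s₂) = t₂ * c₂ * s₂ * q * (t₁ * c₁ * s₁) * w := by
  have conj : ∀ {u s x y : G}, u * s = 1 → s * u = 1 → x * u = u * y → s * x = y * s := by
    intro u s x y hus hsu h
    calc s * x = s * (x * u) * s := by simp only [mul_assoc, hus, mul_one]
      _ = (s * u) * (y * s) := by rw [h]; simp only [mul_assoc]
      _ = y * s := by rw [hsu, one_mul]
  have ep : s₁ * (p * t₂) = t₂ * p * s₁ := conj hu₁ hs₁ (by rw [hp, mul_assoc])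
  have eq : s₂ * (q * t₁) = t₁ * q * s₂ := conj hu₂ hs₂ (by rw [hq, mul_assoc])
  have ew : s₂ * (s₁ * w) = w * s₁ * s₂ := by
    have h : s₁ * (w * u₂) = u₂ * w * s₁ := conj hu₁ hs₁ (by rw [hw, mul_assoc])
    refine conj hu₂ hs₂ ?_
    calc s₁ * w * u₂ = s₁ * (w * u₂) := mul_assoc _ _ _
      _ = u₂ * (w * s₁) := by rw [h, mul_assoc]
  calc r * (t₁ * c₁ * s₁) * p * (t₂ * c₂ * s₂)
      = r * t₁ * c₁ * (s₁ * (p * t₂)) * c₂ * s₂ := by simp only [mul_assoc]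
    _ = r * t₁ * (c₁ * t₂) * p * (s₁ * c₂) * s₂ := by rw [ep]; simp only [mul_assoc]
    _ = (r * t₁ * t₂) * c₁ * p * c₂ * s₁ * s₂ := by
      rw [h₁₂.eq, ← h₂₁'.eq]; simp only [mul_assoc]
    _ = t₂ * t₁ * (r * c₁ * p * c₂) * s₁ * s₂ := by rw [hr]; simp only [mul_assoc]
    _ = t₂ * (t₁ * c₂) * q * c₁ * (w * s₁ * s₂) := by rw [hc]; simp only [mul_assoc]
    _ = t₂ * c₂ * t₁ * q * (c₁ * s₂) * s₁ * w := by
      rw [← ew, ← h₂₁.eq]; simp only [mul_assoc]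
    _ = t₂ * c₂ * (t₁ * q * s₂) * c₁ * s₁ * w := by rw [h₁₂'.eq]; simp only [mul_assoc]
    _ = t₂ * c₂ * s₂ * q * (t₁ * c₁ * s₁) * w := by rw [← eq]; simp only [mul_assoc]

/-- Dressing a scalar solution `B` of the reflection equation by a solution `T` of the
RTT relation yields a solution `b(k) = T(k) B(k) T(−k)⁻¹` of the reflection equation
over the algebra `A`. -/
theorem dressed_reflection_equation {A : Type*} [Ring A] [Algebra ℂ A]
    (N : ℕ) (hN : 1 ≤ N)
    (R : ℂ → ℂ → Matrix (Fin N × Fin N) (Fin N × Fin N) ℂ)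
    (hYBE : ∀ k₁ k₂ k₃ : ℂ,
      emb12 (R k₁ k₂) * emb13 (R k₁ k₃) * emb23 (R k₂ k₃) =
        emb23 (R k₂ k₃) * emb13 (R k₁ k₃) * emb12 (R k₁ k₂))
    (hUnit : ∀ k₁ k₂ : ℂ, R k₁ k₂ * swap21 (R k₂ k₁) = 1)
    (T S : ℂ → Matrix (Fin N) (Fin N) A)
    (hTS : ∀ k, T k * S k = 1) (hST : ∀ k, S k * T k = 1)
    (hRTT : ∀ k₁ k₂ : ℂ,
      (R k₁ k₂).map (algebraMap ℂ A) * emb1 (T k₁) * emb2 (T k₂) =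
        emb2 (T k₂) * emb1 (T k₁) * (R k₁ k₂).map (algebraMap ℂ A))
    (B : ℂ → Matrix (Fin N) (Fin N) ℂ)
    (hBrefl : ∀ k₁ k₂ : ℂ,
      R k₁ k₂ * emb1 (B k₁) * swap21 (R k₂ (-k₁)) * emb2 (B k₂) =
        emb2 (B k₂) * R k₁ (-k₂) * emb1 (B k₁) * swap21 (R (-k₂) (-k₁)))
    (hBunit : ∀ k : ℂ, B k * B (-k) = 1)
    (b : ℂ → Matrix (Fin N) (Fin N) A)
    (hb : ∀ k, b k = T k * (B k).map (algebraMap ℂ A) * S (-k)) :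
    ∀ k₁ k₂ : ℂ,
      (R k₁ k₂).map (algebraMap ℂ A) * emb1 (b k₁) *
          (swap21 (R k₂ (-k₁))).map (algebraMap ℂ A) * emb2 (b k₂) =
        emb2 (b k₂) * (R k₁ (-k₂)).map (algebraMap ℂ A) * emb1 (b k₁) *
          (swap21 (R (-k₂) (-k₁))).map (algebraMap ℂ A) := by
  intro k₁ k₂
  have hRTT21 : ∀ x y : ℂ,
      (swap21 (R x y)).map (algebraMap ℂ A) * emb2 (T x) * emb1 (T y) =
        emb1 (T y) * emb2 (T x) * (swap21 (R x y)).map (algebraMap ℂ A) := by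
    intro x y
    have h := congrArg swap21 (hRTT x y)
    simp only [swap21_mul, swap21_emb1, swap21_emb2] at h
    exact h
  have hc := congrArg (fun X => X.map (algebraMap ℂ A)) (hBrefl k₁ k₂)
  simp only [Matrix.map_mul, ← emb1_map_algebraMap, ← emb2_map_algebraMap] at hc
  simp only [hb, emb1_mul, emb2_mul]
  exact dressed_reflection_of_exchange
    (by rw [← emb1_mul, hTS, emb1_one]) (by rw [← emb1_mul, hST, emb1_one])
    (by rw [← emb2_mul, hTS, emb2_one]) (by rw [← emb2_mul, hST, emb2_one])
    (hRTT k₁ k₂) (hRTT21 k₂ (-k₁)) (hRTT k₁ (-k₂)) (hRTT21 (-k₂) (-k₁)) hc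
    (commute_emb1_map_emb2 _ _) (commute_emb1_map_emb2 _ _)
    (commute_emb2_map_emb1 _ _) (commute_emb2_map_emb1 _ _)
end

section
/- Let A be a ℂ-bialgebra with comultiplication Δ : A → A ⊗[ℂ] A, N ≥ 1, and let T, T' ∈ Matrix (Fin N) (Fin N) A both be comultiplicative (Δ(T_{ab}) = Σ_c T_{ac} ⊗ T_{cb} and likewise for T'). Suppose S ∈ Matrix (Fin N) (Fin N) A is a two-sided inverse of T', and let B ∈ Matrix (Fin N) (Fin N) ℂ be a scalar matrix. Then the matrix b := T · B · S (with B viewed in Matrix (Fin N) (Fin N) A) satisfies the coideal property: Δ(b_{ab}) = Σ_{e,g} (T_{ae} · S_{gb}) ⊗ b_{eg} for all a, b. In particular, the comultiplication of every entry of b lies in A ⊗ C, where C is the subalgebra of A generated by the entries of b. -/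
open TensorProduct

section Comultiplicative

variable {R A n : Type*} [CommSemiring R] [Semiring A] [Bialgebra R A] [Fintype n]

/-- The coproduct law `Δ(T) = T ⊗̇ T` as a factorization of matrices over `A ⊗ A`. -/
theorem map_comulAlgHom_of_comultiplicative {T : Matrix n n A}
    (hT : ∀ i j, Coalgebra.comul (R := R) (T i j) = ∑ k, T i k ⊗ₜ[R] T k j) :
    T.map (Bialgebra.comulAlgHom R A) =
      T.map (Algebra.TensorProduct.includeLeft : A →ₐ[R] A ⊗[R] A) *
        T.map (Algebra.TensorProduct.includeRight : A →ₐ[R] A ⊗[R] A) := by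
  ext i j
  simp [Matrix.mul_apply, hT]

/-- The comultiplication reverses the tensor order on the inverse of a comultiplicative
matrix. -/
theorem map_comulAlgHom_of_inverse [DecidableEq n] {T S : Matrix n n A}
    (hT : ∀ i j, Coalgebra.comul (R := R) (T i j) = ∑ k, T i k ⊗ₜ[R] T k j)
    (hST : S * T = 1) (hTS : T * S = 1) :
    S.map (Bialgebra.comulAlgHom R A) =
      S.map (Algebra.TensorProduct.includeRight : A →ₐ[R] A ⊗[R] A) *
        S.map (Algebra.TensorProduct.includeLeft : A →ₐ[R] A ⊗[R] A) := by
  have map_mul_eq_one (f : A →ₐ[R] A ⊗[R] A) {M M' : Matrix n n A} (h : M * M' = 1) :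
      M.map f * M'.map f = 1 := by
    rw [← Matrix.map_mul, h, Matrix.map_one _ (map_zero f) (map_one f)]
  refine left_inv_eq_right_inv (map_mul_eq_one _ hST) ?_
  rw [map_comulAlgHom_of_comultiplicative hT, Matrix.mul_assoc, ← Matrix.mul_assoc (T.map _) (S.map _),
    map_mul_eq_one _ hTS, Matrix.one_mul, map_mul_eq_one _ hTS]

end Comultiplicative

/-- The coideal property of the dressed matrix `b = T B T'⁻¹`:
`Δ(b_{ab}) = Σ_{e,g} (T_{ae} S_{gb}) ⊗ b_{eg}`, so that `Δ b ⊆ A ⊗ C` where `C` is the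
subalgebra generated by the entries of `b` (the reflection algebra). -/
theorem dressed_coideal {A : Type*} [Ring A] [Bialgebra ℂ A]
    (N : ℕ) (hN : 1 ≤ N)
    (T T' S : Matrix (Fin N) (Fin N) A)
    (hT : ∀ a b : Fin N,
      Coalgebra.comul (R := ℂ) (T a b) = ∑ c : Fin N, T a c ⊗ₜ[ℂ] T c b)
    (hT' : ∀ a b : Fin N,
      Coalgebra.comul (R := ℂ) (T' a b) = ∑ c : Fin N, T' a c ⊗ₜ[ℂ] T' c b)
    (hST : S * T' = 1) (hTS : T' * S = 1)
    (B : Matrix (Fin N) (Fin N) ℂ)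
    (b : Matrix (Fin N) (Fin N) A)
    (hb : b = T * B.map (algebraMap ℂ A) * S) :
    (∀ a c : Fin N,
      Coalgebra.comul (R := ℂ) (b a c) =
        ∑ e : Fin N, ∑ g : Fin N, (T a e * S g c) ⊗ₜ[ℂ] b e g) ∧
    (∀ a c : Fin N,
      Coalgebra.comul (R := ℂ) (b a c) ∈
        LinearMap.range (LinearMap.lTensor A
          (Subalgebra.val (Algebra.adjoin ℂ {x : A | ∃ i j : Fin N, x = b i j})).toLinearMap)) := by
  have map_scalar (f : A →ₐ[ℂ] A ⊗[ℂ] A) :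
      (B.map (algebraMap ℂ A)).map f = B.map (algebraMap ℂ (A ⊗[ℂ] A)) := by
    ext i j
    exact f.commutes (B i j)
  have hΔb : b.map (Bialgebra.comulAlgHom ℂ A) =
      T.map (Algebra.TensorProduct.includeLeft : A →ₐ[ℂ] A ⊗[ℂ] A) *
        b.map (Algebra.TensorProduct.includeRight : A →ₐ[ℂ] A ⊗[ℂ] A) *
        S.map (Algebra.TensorProduct.includeLeft : A →ₐ[ℂ] A ⊗[ℂ] A) := by
    rw [hb]
    simp only [Matrix.map_mul, map_scalar, map_comulAlgHom_of_comultiplicative hT,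
      map_comulAlgHom_of_inverse hT' hST hTS, Matrix.mul_assoc]
  have hcomul (a c : Fin N) : Coalgebra.comul (R := ℂ) (b a c) =
      ∑ e : Fin N, ∑ g : Fin N, (T a e * S g c) ⊗ₜ[ℂ] b e g := by
    have h := congrFun (congrFun hΔb a) c
    simp only [Matrix.map_apply, Matrix.mul_apply, Finset.sum_mul,
      Bialgebra.comulAlgHom_apply, Algebra.TensorProduct.includeLeft_apply,
      Algebra.TensorProduct.includeRight_apply, Algebra.TensorProduct.tmul_mul_tmul,
      one_mul, mul_one] at h
    rw [h, Finset.sum_comm]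
  refine ⟨hcomul, fun a c => ?_⟩
  rw [hcomul]
  exact Submodule.sum_mem _ fun e _ => Submodule.sum_mem _ fun g _ =>
    ⟨(T a e * S g c) ⊗ₜ ⟨b e g, Algebra.subset_adjoin ⟨e, g, rfl⟩⟩, by simp⟩
end

section
/- Let A be a unital associative ℂ-algebra, N ≥ 1, a, a♯ : ℂ → (Fin N → A), and b : ℂ → Matrix (Fin N) (Fin N) A with b(k) · b(−k) = I for all k ∈ ℂ. Define ã(k) := (1/2)·(a(k) + b(k).mulVec (a(−k))) and ã♯(k) := (1/2)·(a♯(k) + (a♯(−k)).vecMul (b(−k))). Then the quadratic expression Σ_i ã♯(k)_i · ã(k)_i is an even function of k: for all k ∈ ℂ, Σ_i ã♯(k)_i · ã(k)_i = Σ_i ã♯(−k)_i · ã(−k)_i. -/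
open Matrix

/-- The quadratic expression `Σ_i ã♯(k)_i ã(k)_i` built from the boundary generators
`ã(k) = ½(a(k) + b(k)a(−k))`, `ã♯(k) = ½(a♯(k) + a♯(−k)b(−k))` is an even function of `k`. -/
theorem boundary_density_even {A : Type*} [Ring A] [Algebra ℂ A]
    (N : ℕ) (hN : 1 ≤ N)
    (a asharp : ℂ → Fin N → A)
    (b : ℂ → Matrix (Fin N) (Fin N) A)
    (hbunit : ∀ k : ℂ, b k * b (-k) = 1)
    (ta tasharp : ℂ → Fin N → A)
    (hta : ∀ k : ℂ, ta k = (1/2 : ℂ) • (a k + (b k).mulVec (a (-k))))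
    (htasharp : ∀ k : ℂ, tasharp k = (1/2 : ℂ) • (asharp k + Matrix.vecMul (asharp (-k)) (b (-k)))) :
    ∀ k : ℂ, ∑ i : Fin N, tasharp k i * ta k i = ∑ i : Fin N, tasharp (-k) i * ta (-k) i := by
  have ta_reflect (k : ℂ) : ta k = (b k).mulVec (ta (-k)) := by
    rw [hta k, hta (-k), mulVec_smul, mulVec_add, mulVec_mulVec, neg_neg, hbunit, one_mulVec,
      add_comm]
  have tasharp_reflect (k : ℂ) : tasharp k = vecMul (tasharp (-k)) (b (-k)) := by
    rw [htasharp k, htasharp (-k), smul_vecMul, add_vecMul, vecMul_vecMul, neg_neg, hbunit,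
      vecMul_one, add_comm]
  intro k
  change tasharp k ⬝ᵥ ta k = tasharp (-k) ⬝ᵥ ta (-k)
  rw [tasharp_reflect k, ← dotProduct_mulVec, ta_reflect (-k), neg_neg]
end

section
/- Let A be a unital associative ℂ-algebra, N ≥ 1, and R : ℂ → ℂ → Matrix (Fin N × Fin N) (Fin N × Fin N) ℂ satisfying unitarity. Let a : ℂ → (Fin N → A), let T : ℂ → Matrix (Fin N) (Fin N) A be well-bred for a with T(k) invertible for every k, let B : ℂ → Matrix (Fin N) (Fin N) ℂ, and set b(k) := T(k) · B(k) · T(−k)⁻¹. Then the exchange relation a₁(k₁) b₂(k₂) = (R(k₂,k₁))₂₁ · b₂(k₂) · R(k₁,−k₂) · a₁(k₁) holds; in components: for all k₁, k₂ ∈ ℂ and i, j, l ∈ Fin N, a(k₁)_i · b(k₂)_{jl} = Σ_{m,n,p,q} (R(k₂,k₁))₂₁_{(i,j),(m,n)} · b(k₂)_{nq} · R(k₁,−k₂)_{(m,q),(p,l)} · a(k₁)_p. -/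
open Matrix

section ExchangeRelations

variable {ι K A : Type*} [Fintype ι] [CommRing K] [Ring A] [Algebra K A]

/-- Multiplying `T₂ a₁ = X a₁ T₂` on the left by an inverse of the scalar matrix `X`. -/
lemma vec_mul_entry_of_exchange [DecidableEq ι]
    {X Y : Matrix (ι × ι) (ι × ι) K} (hYX : Y * X = 1)
    {v : ι → A} {T : Matrix ι ι A}
    (h : ∀ i j l, T j l * v i = ∑ m, ∑ n, X (i, j) (m, n) • (v m * T n l)) (i j l : ι) :
    v i * T j l = ∑ m, ∑ n, Y (i, j) (m, n) • (T n l * v m) := by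
  calc v i * T j l
      = ∑ y : ι × ι, (Y * X) (i, j) y • (v y.1 * T y.2 l) := by
        simp [hYX, Matrix.one_apply, ite_smul]
    _ = ∑ x : ι × ι, Y (i, j) x • ∑ y : ι × ι, X x y • (v y.1 * T y.2 l) := by
        simp only [Matrix.mul_apply, Finset.sum_smul, Finset.smul_sum, mul_smul]
        exact Finset.sum_comm
    _ = ∑ m, ∑ n, Y (i, j) (m, n) • (T n l * v m) := by
        simp only [h, Fintype.sum_prod_type]

/-- Multiplying `T₂ a₁ = X a₁ T₂` on both sides by the inverse `S₂` of `T₂`. -/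
lemma vec_mul_inv_entry_of_exchange [DecidableEq ι] {X : Matrix (ι × ι) (ι × ι) K}
    {v : ι → A} {T S : Matrix ι ι A} (hTS : T * S = 1) (hST : S * T = 1)
    (h : ∀ i j l, T j l * v i = ∑ m, ∑ n, X (i, j) (m, n) • (v m * T n l)) (i j l : ι) :
    v i * S j l = ∑ p, ∑ q, X (i, q) (p, l) • (S j q * v p) := by
  have hright (q : ι) : ∑ s, T q s * v i * S s l = ∑ p, X (i, q) (p, l) • v p := by
    calc ∑ s, T q s * v i * S s l
        = ∑ p, ∑ n, X (i, q) (p, n) • (v p * (T * S) n l) := by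
          simp only [h, Matrix.mul_apply, Finset.sum_mul, Finset.mul_sum, Finset.smul_sum,
            smul_mul_assoc, mul_assoc]
          rw [Finset.sum_comm]
          exact Finset.sum_congr rfl fun p _ => Finset.sum_comm
      _ = ∑ p, X (i, q) (p, l) • v p := by
          simp [hTS, Matrix.one_apply]
  calc v i * S j l
      = ∑ s, (S * T) j s * (v i * S s l) := by
        simp [hST, Matrix.one_apply]
    _ = ∑ q, S j q * ∑ s, T q s * v i * S s l := by
        simp only [Matrix.mul_apply, Finset.sum_mul, Finset.mul_sum, mul_assoc]
        exact Finset.sum_comm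
    _ = ∑ p, ∑ q, X (i, q) (p, l) • (S j q * v p) := by
        simp only [hright, Finset.mul_sum, mul_smul_comm]
        exact Finset.sum_comm

/-- An exchange relation `a₁ T₂ = Y T₂ a₁` persists when `T` is multiplied on the right by a
scalar matrix. -/
lemma vec_mul_entry_mul_map {Y : Matrix (ι × ι) (ι × ι) K} {v : ι → A} {T : Matrix ι ι A}
    (h : ∀ i j l, v i * T j l = ∑ m, ∑ n, Y (i, j) (m, n) • (T n l * v m))
    (B : Matrix ι ι K) (i j l : ι) :
    v i * (T * B.map (algebraMap K A)) j l =
      ∑ m, ∑ n, Y (i, j) (m, n) • ((T * B.map (algebraMap K A)) n l * v m) := by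
  have hentry (n : ι) : (T * B.map (algebraMap K A)) n l = ∑ s, B s l • T n s := by
    simp only [Matrix.mul_apply, Matrix.map_apply, Algebra.smul_def]
    exact Finset.sum_congr rfl fun s _ => (Algebra.commutes _ _).symm
  simp only [hentry, Finset.mul_sum, Finset.sum_mul, mul_smul_comm, smul_mul_assoc, h,
    Finset.smul_sum]
  rw [Finset.sum_comm]
  refine Finset.sum_congr rfl fun m _ => ?_
  rw [Finset.sum_comm]
  exact Finset.sum_congr rfl fun n _ => Finset.sum_congr rfl fun s _ => smul_comm _ _ _

/-- Exchange relations of `a` with `U` and with `S` combine to one with the product `U S`. -/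
lemma vec_mul_entry_mul {X Y : Matrix (ι × ι) (ι × ι) K} {v : ι → A} {U S : Matrix ι ι A}
    (hU : ∀ i j l, v i * U j l = ∑ m, ∑ n, Y (i, j) (m, n) • (U n l * v m))
    (hS : ∀ i j l, v i * S j l = ∑ p, ∑ q, X (i, q) (p, l) • (S j q * v p)) (i j l : ι) :
    v i * (U * S) j l =
      ∑ m, ∑ n, ∑ p, ∑ q,
        (Y (i, j) (m, n) * X (m, q) (p, l)) • ((U * S) n q * v p) := by
  calc v i * (U * S) j l
      = ∑ m, ∑ n, ∑ r, Y (i, j) (m, n) • (U n r * (v m * S r l)) := by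
        simp only [Matrix.mul_apply, Finset.mul_sum, ← mul_assoc, hU, Finset.sum_mul,
          smul_mul_assoc]
        rw [Finset.sum_comm]
        exact Finset.sum_congr rfl fun m _ => Finset.sum_comm
    _ = ∑ m, ∑ n, ∑ p, ∑ q,
          (Y (i, j) (m, n) * X (m, q) (p, l)) • ((U * S) n q * v p) := by
        refine Finset.sum_congr rfl fun m _ => Finset.sum_congr rfl fun n _ => ?_
        simp only [hS, Matrix.mul_apply, Finset.mul_sum, Finset.sum_mul, Finset.smul_sum,
          mul_smul_comm, mul_smul, mul_assoc]
        rw [Finset.sum_comm]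
        exact Finset.sum_congr rfl fun p _ => Finset.sum_comm

end ExchangeRelations

/-- Exchange relation `a₁(k₁) b₂(k₂) = R₂₁(k₂,k₁) b₂(k₂) R(k₁,−k₂) a₁(k₁)` between the ZF
generators `a` and the reflection operator `b(k) = T(k) B(k) T(−k)⁻¹` built from a well-bred
operator `T`. -/
theorem a_b_exchange {A : Type*} [Ring A] [Algebra ℂ A]
    (N : ℕ) (hN : 1 ≤ N)
    (R : ℂ → ℂ → Matrix (Fin N × Fin N) (Fin N × Fin N) ℂ)
    (hUnit : ∀ k₁ k₂ : ℂ, R k₁ k₂ * swap21 (R k₂ k₁) = 1)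
    (a : ℂ → Fin N → A)
    (T S : ℂ → Matrix (Fin N) (Fin N) A)
    (hTS : ∀ k, T k * S k = 1) (hST : ∀ k, S k * T k = 1)
    (hwb : ∀ (k₁ k₂ : ℂ) (i j l : Fin N),
      T k₁ i l * a k₂ j =
        ∑ m : Fin N, ∑ n : Fin N,
          swap21 (R k₂ k₁) (i, j) (m, n) • (a k₂ n * T k₁ m l))
    (B : ℂ → Matrix (Fin N) (Fin N) ℂ)
    (b : ℂ → Matrix (Fin N) (Fin N) A)
    (hb : ∀ k, b k = T k * (B k).map (algebraMap ℂ A) * S (-k)) :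
    ∀ (k₁ k₂ : ℂ) (i j l : Fin N),
      a k₁ i * b k₂ j l =
        ∑ m : Fin N, ∑ n : Fin N, ∑ p : Fin N, ∑ q : Fin N,
          (swap21 (R k₂ k₁) (i, j) (m, n) * R k₁ (-k₂) (m, q) (p, l)) •
            (b k₂ n q * a k₁ p) := by
  intro k₁ k₂ i j l
  have hex (k : ℂ) (i j l : Fin N) : T k j l * a k₁ i =
      ∑ m, ∑ n, R k₁ k (i, j) (m, n) • (a k₁ m * T k n l) := by
    rw [hwb, Finset.sum_comm]
    rfl
  rw [hb]
  exact vec_mul_entry_mul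
    (vec_mul_entry_mul_map
      (vec_mul_entry_of_exchange (mul_eq_one_comm.mp (hUnit k₁ k₂)) (hex k₂)) (B k₂))
    (vec_mul_inv_entry_of_exchange (hTS (-k₂)) (hST (-k₂)) (hex (-k₂))) i j l
end

section
/- Let A be a unital associative ℂ-algebra, N ≥ 1, and R : ℂ → ℂ → Matrix (Fin N × Fin N) (Fin N × Fin N) ℂ satisfying unitarity. Let a♯ : ℂ → (Fin N → A), let T : ℂ → Matrix (Fin N) (Fin N) A be well-bred for the row family a♯ with T(k) invertible for every k, let B : ℂ → Matrix (Fin N) (Fin N) ℂ, and set b(k) := T(k) · B(k) · T(−k)⁻¹. Then the exchange relation b₁(k₁) a♯₂(k₂) = a♯₂(k₂) · R(k₁,k₂) · b₁(k₁) · (R(k₂,−k₁))₂₁ holds; in components: for all k₁, k₂ ∈ ℂ and l, m, n ∈ Fin N, b(k₁)_{lm} · a♯(k₂)_n = Σ_{q,r,s,t} a♯(k₂)_q · R(k₁,k₂)_{(l,q),(r,s)} · b(k₁)_{rt} · (R(k₂,−k₁))₂₁_{(t,s),(m,n)}. -/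
open Matrix

/-- The `(q, n)` block, with respect to the second tensor factor, of a scalar matrix acting on
`ℂ^N ⊗ ℂ^N`, with its entries viewed in the algebra `A`. -/
def sndBlock {N : ℕ} (A : Type*) [Ring A] [Algebra ℂ A]
    (X : Matrix (Fin N × Fin N) (Fin N × Fin N) ℂ) (q n : Fin N) : Matrix (Fin N) (Fin N) A :=
  fun l r => algebraMap ℂ A (X (l, q) (r, n))

theorem sum_sndBlock_mul_sndBlock {N : ℕ} {A : Type*} [Ring A] [Algebra ℂ A]
    {X Y : Matrix (Fin N × Fin N) (Fin N × Fin N) ℂ} (h : X * Y = 1) (q n : Fin N) :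
    ∑ s, sndBlock A X q s * sndBlock A Y s n = if q = n then 1 else 0 := by
  ext l m
  have hX := congrFun (congrFun h (l, q)) (m, n)
  rw [Matrix.mul_apply, Fintype.sum_prod_type, Finset.sum_comm] at hX
  have hA := congrArg (algebraMap ℂ A) hX
  simp only [map_sum, map_mul] at hA
  simp only [Matrix.sum_apply, Matrix.mul_apply, sndBlock]
  rw [hA]
  by_cases hq : q = n <;> by_cases hl : l = m <;> simp [Matrix.one_apply, hq, hl]

theorem map_algebraMap_mul_scalar {N : ℕ} {A : Type*} [Ring A] [Algebra ℂ A]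
    (x : A) (B : Matrix (Fin N) (Fin N) ℂ) :
    B.map (algebraMap ℂ A) * scalar (Fin N) x = scalar (Fin N) x * B.map (algebraMap ℂ A) := by
  ext i j
  simp [Algebra.commutes]

/-- Exchange of the inverse of a well-bred operator with the row family. -/
theorem inverse_mul_scalar {N : ℕ} {A : Type*} [Ring A] [Algebra ℂ A]
    {X Y : Matrix (Fin N × Fin N) (Fin N × Fin N) ℂ} (hXY : X * Y = 1) {a : Fin N → A}
    {T S : Matrix (Fin N) (Fin N) A} (hTS : T * S = 1) (hST : S * T = 1)
    (hT : ∀ n, T * scalar (Fin N) (a n) = ∑ q, scalar (Fin N) (a q) * sndBlock A X q n * T)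
    (n : Fin N) :
    S * scalar (Fin N) (a n) = ∑ s, scalar (Fin N) (a s) * S * sndBlock A Y s n := by
  have key (s : Fin N) :
      scalar (Fin N) (a s) * S = ∑ q, S * scalar (Fin N) (a q) * sndBlock A X q s := by
    calc scalar (Fin N) (a s) * S = S * (T * scalar (Fin N) (a s)) * S := by
          rw [← mul_assoc, hST, one_mul]
      _ = ∑ q, S * scalar (Fin N) (a q) * sndBlock A X q s := by
          rw [hT, Finset.mul_sum, Finset.sum_mul]
          refine Finset.sum_congr rfl fun q _ => ?_
          simp only [mul_assoc, hTS, mul_one]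
  simp_rw [key, Finset.sum_mul]
  rw [Finset.sum_comm]
  simp_rw [mul_assoc, ← Finset.mul_sum, sum_sndBlock_mul_sndBlock hXY]
  simp

/-- Exchange relation `b₁(k₁) a♯₂(k₂) = a♯₂(k₂) R(k₁,k₂) b₁(k₁) R₂₁(k₂,−k₁)` between the
creation generators `a♯` and the reflection operator `b(k) = T(k) B(k) T(−k)⁻¹` built from
an operator `T` well-bred for the row family `a♯`. -/
theorem b_asharp_exchange {A : Type*} [Ring A] [Algebra ℂ A]
    (N : ℕ) (hN : 1 ≤ N)
    (R : ℂ → ℂ → Matrix (Fin N × Fin N) (Fin N × Fin N) ℂ)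
    (hUnit : ∀ k₁ k₂ : ℂ, R k₁ k₂ * swap21 (R k₂ k₁) = 1)
    (asharp : ℂ → Fin N → A)
    (T S : ℂ → Matrix (Fin N) (Fin N) A)
    (hTS : ∀ k, T k * S k = 1) (hST : ∀ k, S k * T k = 1)
    (hwb : ∀ (k₁ k₂ : ℂ) (l m n : Fin N),
      T k₁ l m * asharp k₂ n =
        ∑ q : Fin N, ∑ r : Fin N,
          R k₁ k₂ (l, q) (r, n) • (asharp k₂ q * T k₁ r m))
    (B : ℂ → Matrix (Fin N) (Fin N) ℂ)
    (b : ℂ → Matrix (Fin N) (Fin N) A)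
    (hb : ∀ k, b k = T k * (B k).map (algebraMap ℂ A) * S (-k)) :
    ∀ (k₁ k₂ : ℂ) (l m n : Fin N),
      b k₁ l m * asharp k₂ n =
        ∑ q : Fin N, ∑ r : Fin N, ∑ s : Fin N, ∑ t : Fin N,
          (R k₁ k₂ (l, q) (r, s) * swap21 (R k₂ (-k₁)) (t, s) (m, n)) •
            (asharp k₂ q * b k₁ r t) := by
  intro k₁ k₂ l m n
  have hT (k : ℂ) (n : Fin N) : T k * scalar (Fin N) (asharp k₂ n) =
      ∑ q, scalar (Fin N) (asharp k₂ q) * sndBlock A (R k k₂) q n * T k := by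
    ext l m
    simp only [mul_assoc, scalar_apply, mul_diagonal, diagonal_mul, Matrix.sum_apply, hwb]
    simp only [Matrix.mul_apply, sndBlock, Finset.mul_sum]
    refine Finset.sum_congr rfl fun q _ => Finset.sum_congr rfl fun r _ => ?_
    rw [← Algebra.smul_def, mul_smul_comm]
  have hS := inverse_mul_scalar (hUnit (-k₁) k₂) (hTS (-k₁)) (hST (-k₁)) (hT (-k₁)) n
  have hbD : b k₁ * scalar (Fin N) (asharp k₂ n) =
      ∑ s, ∑ q, scalar (Fin N) (asharp k₂ q) * (sndBlock A (R k₁ k₂) q s * b k₁ *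
        sndBlock A (swap21 (R k₂ (-k₁))) s n) := by
    rw [hb, mul_assoc, hS, Finset.mul_sum]
    refine Finset.sum_congr rfl fun s _ => ?_
    calc T k₁ * (B k₁).map (algebraMap ℂ A) * (scalar (Fin N) (asharp k₂ s) * S (-k₁) *
          sndBlock A (swap21 (R k₂ (-k₁))) s n)
        = T k₁ * ((B k₁).map (algebraMap ℂ A) * scalar (Fin N) (asharp k₂ s)) * S (-k₁) *
          sndBlock A (swap21 (R k₂ (-k₁))) s n := by simp only [mul_assoc]
      _ = T k₁ * scalar (Fin N) (asharp k₂ s) * (B k₁).map (algebraMap ℂ A) * S (-k₁) *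
          sndBlock A (swap21 (R k₂ (-k₁))) s n := by
        rw [map_algebraMap_mul_scalar]; simp only [mul_assoc]
      _ = _ := by
        rw [hT]; simp only [Finset.sum_mul, mul_assoc]
  have h := congrFun (congrFun hbD l) m
  simp only [scalar_apply, mul_diagonal, diagonal_mul, Matrix.sum_apply] at h
  simp only [Matrix.mul_apply, sndBlock, Finset.mul_sum, Finset.sum_mul] at h
  rw [h, Finset.sum_comm]
  refine Finset.sum_congr rfl fun q _ => ?_
  rw [Finset.sum_congr rfl fun s _ => Finset.sum_comm, Finset.sum_comm]
  refine Finset.sum_congr rfl fun r _ => Finset.sum_congr rfl fun s _ =>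
    Finset.sum_congr rfl fun t _ => ?_
  rw [← Algebra.smul_def, ← Algebra.commutes, ← Algebra.smul_def, smul_smul, mul_smul_comm,
    mul_comm]
end
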